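/- Let G = (V, E, w, μ) be a weighted submodular hypergraph with symmetric submodular cut functions δ_h (δ_h(∅) = δ_h(h) = 0, δ_h(S) = δ_h(h \ S)), strictly positive vertex weights μ, and let x ∈ ℝ^V be a non-constant vector. Then there exists a threshold τ ∈ ℝ such that the set S = {i ∈ V : x_i ≥ τ} satisfies ∅ ≠ S ≠ V and δ_G(S)/min{μ(S), μ(V \ S)} ≤ δ̄_G(x)/δ̄_μ(x), where δ̄_G(x) = ∑_{h∈E} w_h δ̄_h(x) and δ̄_μ is the Lovász extension of S ↦ min{μ(S), μ(V \ S)}. -/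

import Mathlib

open Finset
open scoped Classical

/-- Membership in the base polytope `B(δ_h)` of the submodular cut function `δ` on
subsets of the hyperedge `h`, for vectors of `ℝ^V` supported on `h`. -/
def memBaseOn {V : Type*} [Fintype V] [DecidableEq V]
    (h : Finset V) (δ : Finset V → ℝ) (y : V → ℝ) : Prop :=
  (∀ i, i ∉ h → y i = 0) ∧ (∑ i ∈ h, y i) = δ h ∧ ∀ S ⊆ h, (∑ i ∈ S, y i) ≤ δ S

/-- The Lovász extension `δ̄_h(x) = max_{y ∈ B(δ_h)} ⟨y, x⟩`. -/
noncomputable def lovaszOn {V : Type*} [Fintype V] [DecidableEq V]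
    (h : Finset V) (δ : Finset V → ℝ) (x : V → ℝ) : ℝ :=
  sSup {r | ∃ y : V → ℝ, memBaseOn h δ y ∧ r = ∑ i, y i * x i}

/-- Initial segment of the enumeration with rank function `r`. -/
def sweepSeg {V : Type*} [Fintype V] [DecidableEq V] (r : V → ℕ) (k : ℕ) : Finset V :=
  Finset.univ.filter fun i => r i < k

/-- A sorted enumeration of the vertices. -/
structure SweepEnum {V : Type*} [Fintype V] [DecidableEq V] (x : V → ℝ) (m : ℕ)
    (p : ℕ → V) (r : V → ℕ) : Prop where
  pr : ∀ v, p (r v) = v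
  rp : ∀ k, k ≤ m → r (p k) = k
  rle : ∀ v, r v ≤ m
  anti : ∀ j k, j ≤ k → k ≤ m → x (p k) ≤ x (p j)

section
variable {V : Type*} [Fintype V] [DecidableEq V] {x : V → ℝ} {m : ℕ} {p : ℕ → V} {r : V → ℕ}

theorem sweep_exists (x : V → ℝ) [Nonempty V] : ∃ m p r, SweepEnum x m p r := by
  obtain ⟨m, hm⟩ : ∃ m, Fintype.card V = m + 1 :=
    ⟨Fintype.card V - 1, by have := Fintype.card_pos (α := V); omega⟩
  let e : V ≃ Fin (m+1) := Fintype.equivFinOfCardEq hm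
  let s := Tuple.sort (fun k => - x (e.symm k))
  have hs : Monotone ((fun k => - x (e.symm k)) ∘ s) := Tuple.monotone_sort _
  refine ⟨m, fun k => e.symm (s (Fin.ofNat (m+1) k)), fun v => (s.symm (e v)).val, ?_, ?_, ?_, ?_⟩
  · intro v
    simp
  · intro k hk
    simp [Nat.mod_eq_of_lt (Nat.lt_succ_of_le hk)]
  · intro v
    exact Nat.le_of_lt_succ (s.symm (e v)).isLt
  · intro j k hjk hk
    have : (Fin.ofNat (m+1) j) ≤ Fin.ofNat (m+1) k := by
      rw [Fin.le_def]
      simp [Nat.mod_eq_of_lt (Nat.lt_succ_of_le hk),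
        Nat.mod_eq_of_lt (Nat.lt_succ_of_le (hjk.trans hk)), hjk]
    have := hs this
    simpa using this

theorem seg_zero (r : V → ℕ) : sweepSeg r 0 = ∅ := by simp [sweepSeg]

theorem seg_top (H : SweepEnum x m p r) : sweepSeg r (m+1) = univ := by
  ext v; simp [sweepSeg, H.rle v]

theorem seg_notMem (H : SweepEnum x m p r) {k : ℕ} (hk : k ≤ m) : p k ∉ sweepSeg r k := by
  simp [sweepSeg, H.rp k hk]

theorem seg_succ (H : SweepEnum x m p r) {k : ℕ} (hk : k ≤ m) :
    sweepSeg r (k+1) = insert (p k) (sweepSeg r k) := by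
  ext v
  simp only [sweepSeg, mem_filter, mem_univ, true_and, mem_insert]
  constructor
  · intro h
    rcases Nat.lt_succ_iff_lt_or_eq.mp h with h | h
    · exact Or.inr h
    · left; rw [← h, H.pr]
  · rintro (h | h)
    · rw [h, H.rp k hk]; omega
    · omega

theorem seg_abel (H : SweepEnum x m p r) (y : V → ℝ) (k : ℕ) (hk : k ≤ m) :
    ∑ i ∈ sweepSeg r (k+1), y i * x i =
      ∑ j ∈ range k, (x (p j) - x (p (j+1))) * (∑ i ∈ sweepSeg r (j+1), y i)
        + x (p k) * ∑ i ∈ sweepSeg r (k+1), y i := by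
  induction k with
  | zero =>
    rw [seg_succ H hk, seg_zero]; simp [mul_comm]
  | succ k ih =>
    rw [seg_succ H hk, sum_insert (seg_notMem H hk), sum_insert (seg_notMem H hk),
      ih (by omega), sum_range_succ]
    ring

theorem seg_inner (H : SweepEnum x m p r) (y : V → ℝ) (h0 : ∑ i, y i = 0) :
    ∑ i, y i * x i =
      ∑ j ∈ range m, (x (p j) - x (p (j+1))) * (∑ i ∈ sweepSeg r (j+1), y i) := by
  have := seg_abel H y m le_rfl
  rw [seg_top H, h0] at this
  simpa using this

theorem seg_lovasz (H : SweepEnum x m p r) (h : Finset V) (F : Finset V → ℝ)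
    (hF0 : F ∅ = 0) (hFh : F h = 0)
    (hsub : ∀ A B : Finset V, A ⊆ h → B ⊆ h → F (A ∪ B) + F (A ∩ B) ≤ F A + F B) :
    lovaszOn h F x =
      ∑ j ∈ range m, (x (p j) - x (p (j+1))) * F (sweepSeg r (j+1) ∩ h) := by
  have hsum : ∀ y : V → ℝ, (∀ i, i ∉ h → y i = 0) → ∀ S : Finset V,
      ∑ i ∈ S, y i = ∑ i ∈ S ∩ h, y i := by
    intro y hy S
    symm
    apply sum_subset inter_subset_left
    intro i hi hi'
    apply hy
    intro hh
    exact hi' (mem_inter.2 ⟨hi, hh⟩)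
  unfold lovaszOn
  apply IsGreatest.csSup_eq
  constructor
  · let y : V → ℝ := fun v => F (sweepSeg r (r v + 1) ∩ h) - F (sweepSeg r (r v) ∩ h)
    have hyp : ∀ k, k ≤ m → y (p k) = F (sweepSeg r (k + 1) ∩ h) - F (sweepSeg r k ∩ h) := by
      intro k hk
      simp only [y, H.rp k hk]
    have hy0 : ∀ i, i ∉ h → y i = 0 := by
      intro i hi
      have h1 := seg_succ H (H.rle i)
      rw [H.pr] at h1
      simp only [y]
      rw [h1, insert_inter_of_notMem hi, sub_self]
    have hyC : ∀ k, k ≤ m + 1 → ∑ i ∈ sweepSeg r k, y i = F (sweepSeg r k ∩ h) := by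
      intro k
      induction k with
      | zero => intro _; simp [seg_zero, hF0]
      | succ k ih =>
        intro hk
        have hk' : k ≤ m := by omega
        conv_lhs => rw [seg_succ H hk']
        rw [sum_insert (seg_notMem H hk'), ih (by omega), hyp k hk']
        ring
    have hyS : ∀ S ⊆ h, ∀ k, k ≤ m + 1 → ∑ i ∈ sweepSeg r k ∩ S, y i ≤ F (sweepSeg r k ∩ S) := by
      intro S hS k
      induction k with
      | zero => intro _; simp [seg_zero, hF0]
      | succ k ih =>
        intro hk
        have hk' : k ≤ m := by omega
        have ih := ih (by omega)
        by_cases hp : p k ∈ S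
        · have hn : p k ∉ sweepSeg r k ∩ S := fun hh => seg_notMem H hk' (mem_inter.1 hh).1
          have e1 : sweepSeg r (k+1) ∩ S = insert (p k) (sweepSeg r k ∩ S) := by
            rw [seg_succ H hk', insert_inter_of_mem hp]
          have e2 : sweepSeg r (k+1) ∩ h = insert (p k) (sweepSeg r k ∩ h) := by
            rw [seg_succ H hk', insert_inter_of_mem (hS hp)]
          have hs := hsub (sweepSeg r (k+1) ∩ S) (sweepSeg r k ∩ h)
            (inter_subset_right.trans hS) inter_subset_right
          have e3 : (sweepSeg r (k+1) ∩ S) ∪ (sweepSeg r k ∩ h) = sweepSeg r (k+1) ∩ h := by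
            rw [e1, e2]
            ext v
            simp only [mem_union, mem_insert, mem_inter]
            have := @hS v
            tauto
          have e4 : (sweepSeg r (k+1) ∩ S) ∩ (sweepSeg r k ∩ h) = sweepSeg r k ∩ S := by
            rw [e1]
            ext v
            simp only [mem_insert, mem_inter]
            have h1 := @hS v
            have h2 : v = p k → v ∉ sweepSeg r k := by
              rintro rfl; exact seg_notMem H hk'
            tauto
          rw [e3, e4] at hs
          conv_lhs => rw [e1]
          rw [sum_insert hn, hyp k hk']
          linarith
        · rw [seg_succ H hk', insert_inter_of_notMem hp]
          exact ih
    have htot : ∑ i, y i = 0 := by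
      rw [← seg_top H, hyC _ le_rfl, seg_top H, univ_inter, hFh]
    refine ⟨y, ⟨hy0, ?_, ?_⟩, ?_⟩
    · rw [hFh, ← htot, hsum y hy0 univ, univ_inter]
    · intro S hS
      have := hyS S hS (m+1) le_rfl
      rwa [seg_top H, univ_inter] at this
    · rw [seg_inner H y htot]
      apply sum_congr rfl
      intro j hj
      rw [hyC _ (by have := mem_range.1 hj; omega)]
  · rintro _ ⟨y, ⟨hy0, hyt, hyS⟩, rfl⟩
    have htot : ∑ i, y i = 0 := by
      rw [hsum y hy0 univ, univ_inter, hyt, hFh]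
    rw [seg_inner H y htot]
    apply sum_le_sum
    intro j hj
    have hj := mem_range.1 hj
    apply mul_le_mul_of_nonneg_left
    · rw [hsum y hy0]
      exact hyS _ inter_subset_right
    · have := H.anti j (j+1) (by omega) (by omega)
      linarith

theorem seg_threshold (H : SweepEnum x m p r) {k : ℕ} (hk : k < m)
    (hlt : x (p (k+1)) < x (p k)) :
    (Finset.univ.filter fun i => x (p k) ≤ x i) = sweepSeg r (k+1) := by
  ext v
  simp only [sweepSeg, mem_filter, mem_univ, true_and]
  constructor
  · intro h
    by_contra hc
    have := H.anti (k+1) (r v) (by omega) (H.rle v)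
    rw [H.pr] at this
    linarith
  · intro h
    have := H.anti (r v) k (by omega) (by omega)
    rwa [H.pr] at this

theorem min_submod (μ : V → ℝ) (hμ : ∀ i, 0 < μ i) (A B : Finset V) :
    min (∑ i ∈ A ∪ B, μ i) (∑ i ∈ (A ∪ B)ᶜ, μ i) + min (∑ i ∈ A ∩ B, μ i) (∑ i ∈ (A ∩ B)ᶜ, μ i)
      ≤ min (∑ i ∈ A, μ i) (∑ i ∈ Aᶜ, μ i) + min (∑ i ∈ B, μ i) (∑ i ∈ Bᶜ, μ i) := by
  have h0 := sum_union_inter (s₁ := A) (s₂ := B) (f := μ)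
  have hc : ∀ S : Finset V, ∑ i ∈ Sᶜ, μ i = ∑ i, μ i - ∑ i ∈ S, μ i := by
    intro S
    have := sum_add_sum_compl S μ
    linarith
  have hm : ∀ S T : Finset V, S ⊆ T → ∑ i ∈ S, μ i ≤ ∑ i ∈ T, μ i := fun S T hST =>
    sum_le_sum_of_subset_of_nonneg hST fun i _ _ => (hμ i).le
  have h1 := hm _ _ (inter_subset_left : A ∩ B ⊆ A)
  have h2 := hm _ _ (inter_subset_right : A ∩ B ⊆ B)
  have h3 := hm _ _ (subset_union_left : A ⊆ A ∪ B)
  have h4 := hm _ _ (subset_union_right : B ⊆ A ∪ B)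
  simp only [hc]
  rcases min_choice (∑ i ∈ A, μ i) (∑ i, μ i - ∑ i ∈ A, μ i) with ha | ha <;>
  rcases min_choice (∑ i ∈ B, μ i) (∑ i, μ i - ∑ i ∈ B, μ i) with hb | hb <;>
  rw [ha, hb] <;>
  have a1 := min_le_left (∑ i ∈ A ∪ B, μ i) (∑ i, μ i - ∑ i ∈ A ∪ B, μ i) <;>
  have a2 := min_le_right (∑ i ∈ A ∪ B, μ i) (∑ i, μ i - ∑ i ∈ A ∪ B, μ i) <;>
  have a3 := min_le_left (∑ i ∈ A ∩ B, μ i) (∑ i, μ i - ∑ i ∈ A ∩ B, μ i) <;>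
  have a4 := min_le_right (∑ i ∈ A ∩ B, μ i) (∑ i, μ i - ∑ i ∈ A ∩ B, μ i) <;>
  linarith

end

/-- threshold rounding. For a weighted submodular hypergraph with
symmetric submodular cut functions, strictly positive vertex weights, and a non-constant
vector `x`, some sweep cut `S = {i : x i ≥ τ}` is nontrivial and has ratio-cut value at
most `δ̄_G(x) / δ̄_μ(x)`. -/
theorem sweep_cut_rounding
    {V E : Type*} [Fintype V] [DecidableEq V] [Fintype E]
    (hyper : E → Finset V) (w : E → ℝ) (μ : V → ℝ) (δ : E → Finset V → ℝ)
    (hw : ∀ e, 0 < w e) (hμ : ∀ i, 0 < μ i)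
    (hsub : ∀ e, ∀ A B : Finset V, A ⊆ hyper e → B ⊆ hyper e →
      δ e (A ∪ B) + δ e (A ∩ B) ≤ δ e A + δ e B)
    (hδ0 : ∀ e, δ e ∅ = 0)
    (hδh : ∀ e, δ e (hyper e) = 0)
    (hsym : ∀ e, ∀ S ⊆ hyper e, δ e S = δ e (hyper e \ S))
    (x : V → ℝ) (hx : ¬ ∃ c : ℝ, ∀ i, x i = c) :
    ∃ τ : ℝ,
      (Finset.univ.filter fun i => τ ≤ x i) ≠ ∅ ∧
      (Finset.univ.filter fun i => τ ≤ x i) ≠ Finset.univ ∧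
      (∑ e, w e * δ e ((Finset.univ.filter fun i => τ ≤ x i) ∩ hyper e)) /
          min (∑ i ∈ Finset.univ.filter fun i => τ ≤ x i, μ i)
            (∑ i ∈ (Finset.univ.filter fun i => τ ≤ x i)ᶜ, μ i) ≤
        (∑ e, w e * lovaszOn (hyper e) (δ e) x) /
          lovaszOn Finset.univ (fun S => min (∑ i ∈ S, μ i) (∑ i ∈ Sᶜ, μ i)) x := by
  have hne : Nonempty V := by
    by_contra hV
    rw [not_nonempty_iff] at hV
    exact hx ⟨0, fun i => hV.elim i⟩
  obtain ⟨m, p, r, H⟩ := sweep_exists x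
  set M : Finset V → ℝ := fun S => min (∑ i ∈ S, μ i) (∑ i ∈ Sᶜ, μ i) with hM
  have hLμ : lovaszOn Finset.univ M x =
      ∑ j ∈ range m, (x (p j) - x (p (j+1))) * M (sweepSeg r (j+1)) := by
    rw [seg_lovasz H Finset.univ M]
    · simp
    · simp only [hM, sum_empty]
      exact min_eq_left (sum_nonneg fun i _ => (hμ i).le)
    · simp only [hM, compl_univ, sum_empty]
      exact min_eq_right (sum_nonneg fun i _ => (hμ i).le)
    · intro A B _ _
      exact min_submod μ hμ A B
  set c : Finset V → ℝ := fun S => ∑ e, w e * δ e (S ∩ hyper e) with hc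
  have hLG : (∑ e, w e * lovaszOn (hyper e) (δ e) x) =
      ∑ j ∈ range m, (x (p j) - x (p (j+1))) * c (sweepSeg r (j+1)) := by
    have : ∀ e, w e * lovaszOn (hyper e) (δ e) x =
        ∑ j ∈ range m, (x (p j) - x (p (j+1))) * (w e * δ e (sweepSeg r (j+1) ∩ hyper e)) := by
      intro e
      rw [seg_lovasz H (hyper e) (δ e) (hδ0 e) (hδh e) (hsub e), mul_sum]
      apply sum_congr rfl
      intro j _
      ring
    simp only [this]
    rw [sum_comm]
    apply sum_congr rfl
    intro j _
    rw [hc, mul_sum]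
  have hd : ∀ j, j < m → 0 ≤ x (p j) - x (p (j+1)) := by
    intro j hj
    have := H.anti j (j+1) (by omega) (by omega)
    linarith
  have hin : ∀ j, j < m → p 0 ∈ sweepSeg r (j+1) := by
    intro j hj
    simp [sweepSeg, H.rp 0 (by omega)]
  have hout : ∀ j, j < m → p m ∉ sweepSeg r (j+1) := by
    intro j hj
    simp [sweepSeg, H.rp m le_rfl]
    omega
  have hMpos : ∀ j, j < m → 0 < M (sweepSeg r (j+1)) := by
    intro j hj
    apply lt_min
    · exact sum_pos (fun i _ => hμ i) ⟨_, hin j hj⟩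
    · exact sum_pos (fun i _ => hμ i) ⟨p m, mem_compl.2 (hout j hj)⟩
  obtain ⟨j₀, hj₀, hlt₀⟩ : ∃ j, j < m ∧ x (p (j+1)) < x (p j) := by
    by_contra hcon
    push Not at hcon
    apply hx
    refine ⟨x (p 0), ?_⟩
    have key : ∀ k, k ≤ m → x (p k) = x (p 0) := by
      intro k
      induction k with
      | zero => intro _; rfl
      | succ k ih =>
        intro hk
        have h1 := hcon k (by omega)
        have h2 := ih (by omega)
        have h3 := H.anti 0 (k+1) (by omega) hk
        linarith
    intro i
    have := key (r i) (H.rle i)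
    rwa [H.pr] at this
  have hBpos : 0 < lovaszOn Finset.univ M x := by
    rw [hLμ]
    apply sum_pos'
    · intro j hj
      have hj := mem_range.1 hj
      exact mul_nonneg (hd j hj) (hMpos j hj).le
    · exact ⟨j₀, mem_range.2 hj₀, mul_pos (by linarith) (hMpos j₀ hj₀)⟩
  by_contra hcon
  push Not at hcon
  set R := (∑ e, w e * lovaszOn (hyper e) (δ e) x) / lovaszOn Finset.univ M x with hR
  have hstrict : ∀ j, j < m → x (p (j+1)) < x (p j) →
      R * M (sweepSeg r (j+1)) < c (sweepSeg r (j+1)) := by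
    intro j hj hlt
    have h1 := hcon (x (p j))
    rw [seg_threshold H hj hlt] at h1
    have h2 := h1 ⟨_, hin j hj⟩
      (fun h => hout j hj (by rw [h]; exact mem_univ _))
    exact (lt_div_iff₀ (hMpos j hj)).1 h2
  have hRB : R * lovaszOn Finset.univ M x = ∑ e, w e * lovaszOn (hyper e) (δ e) x :=
    div_mul_cancel₀ _ hBpos.ne'
  rw [hLμ, hLG, mul_sum] at hRB
  refine absurd hRB (ne_of_lt ?_)
  apply sum_lt_sum
  · intro j hj
    have hj := mem_range.1 hj
    rcases (hd j hj).eq_or_lt with h | h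
    · rw [← h]; simp
    · have := mul_lt_mul_of_pos_left (hstrict j hj (by linarith)) h
      linarith
  · refine ⟨j₀, mem_range.2 hj₀, ?_⟩
    have := mul_lt_mul_of_pos_left (hstrict j₀ hj₀ hlt₀) (sub_pos.2 hlt₀)
    linarith
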